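/- arXiv:2407.21722 — 7 statements merged into one kernel-verified Lean document; each statement's English description precedes it below -/
import Mathlib

section
/- Let j ∈ ℤ, l ∈ ℕ, and let f be 2l-times differentiable on (0,∞). Then for all x > 0, (D_j^{2l} f)(x) = Σ_{i=0}^{l} binom(l, i) · (l−j)^{\underline{l−i}} · x^i · f^{(l+i)}(x), where a^{\underline{k}} = a(a−1)⋯(a−k+1) denotes the falling factorial. -/
open MeasureTheory Real Filter Asymptotics

/-- The basis functions `s_{n,k}(x) = (nx)^k / k! · e^{-nx}` for `k ≥ 0`, and `0` for `k < 0`. -/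
noncomputable def szk (n : ℝ) (k : ℤ) (x : ℝ) : ℝ :=
  if k < 0 then 0 else (n * x) ^ k.toNat / (Nat.factorial k.toNat) * Real.exp (-n * x)

/-- Membership in `E_A`: locally integrable on `[0,∞)` and `|f t| ≤ K e^{A t}` for some `K > 0`. -/
def MemEA (A : ℝ) (f : ℝ → ℝ) : Prop :=
  LocallyIntegrableOn f (Set.Ici 0) volume ∧ ∃ K > 0, ∀ t ≥ (0:ℝ), |f t| ≤ K * Real.exp (A * t)

/-- The Szász-Mirakjan-Durrmeyer type operator `S_{n,j}`. -/
noncomputable def Snj (n : ℝ) (j : ℤ) (f : ℝ → ℝ) (x : ℝ) : ℝ :=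
  f 0 * ∑ k ∈ Finset.range j.toNat, szk n k x
    + ∑' k : ℕ, szk n (max 0 j + k) x *
        (n * ∫ t in Set.Ioi (0:ℝ), szk n (max 0 j + k - j) t * f t)

/-- The differential operator `D_j^{2l} f = e_j D^l (e_{l-j} D^l f)` on `(0,∞)`. -/
noncomputable def D2l (j : ℤ) (l : ℕ) (f : ℝ → ℝ) (x : ℝ) : ℝ :=
  x ^ j * iteratedDeriv l (fun t => t ^ ((l : ℤ) - j) * iteratedDeriv l f t) x

/-- The falling factorial `a^{\underline{k}} = a (a-1) ⋯ (a-k+1)`. -/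
def fallFac (a : ℤ) (k : ℕ) : ℤ := ∏ t ∈ Finset.range k, (a - t)

/-- The Leibniz rule on an open set, assuming only that the iterated derivatives of order less
than `n` are differentiable there. -/
theorem iteratedDeriv_mul_of_differentiableAt {s : Set ℝ} (hs : IsOpen s) {g h : ℝ → ℝ} (n : ℕ)
    (hg : ∀ i < n, ∀ x ∈ s, DifferentiableAt ℝ (iteratedDeriv i g) x)
    (hh : ∀ i < n, ∀ x ∈ s, DifferentiableAt ℝ (iteratedDeriv i h) x) :
    ∀ x ∈ s, iteratedDeriv n (fun t => g t * h t) x =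
      ∑ p ∈ Finset.HasAntidiagonal.antidiagonal n,
        (n.choose p.1 : ℝ) * (iteratedDeriv p.1 g x * iteratedDeriv p.2 h x) := by
  induction n with
  | zero => simp
  | succ n ih =>
    intro x hx
    have hev : iteratedDeriv n (fun t => g t * h t) =ᶠ[nhds x] fun t =>
        ∑ p ∈ Finset.HasAntidiagonal.antidiagonal n,
          (n.choose p.1 : ℝ) * (iteratedDeriv p.1 g t * iteratedDeriv p.2 h t) := by
      filter_upwards [hs.mem_nhds hx] with t ht
      exact ih (fun i hi => hg i (by omega)) (fun i hi => hh i (by omega)) t ht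
    rw [iteratedDeriv_succ, hev.deriv_eq, Finset.sum_antidiagonal_choose_succ_mul
      (fun a b => iteratedDeriv a g x * iteratedDeriv b h x), ← Finset.sum_add_distrib]
    refine (HasDerivAt.fun_sum fun p hp => ?_).deriv
    have hp' := Finset.HasAntidiagonal.mem_antidiagonal.mp hp
    have hg' := (hg p.1 (by omega) x hx).hasDerivAt
    have hh' := (hh p.2 (by omega) x hx).hasDerivAt
    rw [← iteratedDeriv_succ] at hg' hh'
    refine ((hg'.mul hh').const_mul (n.choose p.1 : ℝ)).congr_deriv ?_
    rw [Nat.choose_symm_of_eq_add (show n = p.2 + p.1 by omega)]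
    ring

theorem iteratedDeriv_zpow_eq_fallFac (m : ℤ) (k : ℕ) :
    iteratedDeriv k (fun t : ℝ => t ^ m) = fun t => (fallFac m k : ℝ) * t ^ (m - k) := by
  rw [iteratedDeriv_eq_iterate, iter_deriv_zpow']
  simp [fallFac]

/-- Explicit representation of the differential operator `D_j^{2l}`. -/
theorem D2l_explicit (j : ℤ) (l : ℕ) (f : ℝ → ℝ)
    (hdiff : ∀ i < 2 * l, ∀ x > (0:ℝ), DifferentiableAt ℝ (iteratedDeriv i f) x) :
    ∀ x > (0:ℝ),
      D2l j l f x
        = ∑ i ∈ Finset.range (l + 1),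
            (Nat.choose l i : ℝ) * (fallFac ((l : ℤ) - j) (l - i) : ℝ) * x ^ i *
              iteratedDeriv (l + i) f x := by
  intro x hx
  have hiter : ∀ i, iteratedDeriv i (iteratedDeriv l f) = iteratedDeriv (l + i) f := fun i => by
    simp only [iteratedDeriv_eq_iterate]
    rw [← Function.iterate_add_apply, add_comm]
  rw [D2l, iteratedDeriv_mul_of_differentiableAt isOpen_Ioi l ?_ ?_ x hx,
    ← Finset.Nat.sum_antidiagonal_swap, Finset.Nat.sum_antidiagonal_eq_sum_range_succ_mk,
    Finset.mul_sum]
  · refine Finset.sum_congr rfl fun i hi => ?_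
    have hil : i ≤ l := Nat.lt_succ_iff.mp (Finset.mem_range.mp hi)
    have hpow : x ^ j * x ^ ((l : ℤ) - j - (l - i : ℕ)) = x ^ i := by
      rw [← zpow_add₀ hx.ne', ← zpow_natCast]
      congr 1
      omega
    simp only [Prod.swap, hiter, iteratedDeriv_zpow_eq_fallFac, Nat.choose_symm hil]
    rw [← hpow]
    ring
  · intro i _ t ht
    rw [iteratedDeriv_zpow_eq_fallFac]
    exact (differentiableAt_zpow.mpr (Or.inl (ne_of_gt ht))).const_mul _
  · intro i hi t ht
    rw [hiter]
    exact hdiff _ (by omega) t ht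
end

section
/- Let j ∈ ℤ and p ∈ ℝ, and define g_{j,p}(x) = Σ_{m=max(0,−j)}^{∞} p^m x^{m+j} / (m! (m+j)!) for x ≥ 0. Then for every n > 0, g_{j,p} is an eigenfunction of S_{n,j} with eigenvalue e^{p/n}: (S_{n,j} g_{j,p})(x) = e^{p/n} g_{j,p}(x) for all x ≥ 0. -/
open MeasureTheory Real Filter Asymptotics

/-- The eigenfunctions `g_{j,p}(x) = Σ_{m=max(0,-j)}^∞ p^m x^{m+j} / (m! (m+j)!)`,
reindexed via `m = max(0,-j) + k`. -/
noncomputable def gjp (j : ℤ) (p : ℝ) (x : ℝ) : ℝ :=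
  ∑' k : ℕ, p ^ ((-j).toNat + k) * x ^ ((((-j).toNat + k : ℕ) + j).toNat) /
    (Nat.factorial ((-j).toNat + k) * Nat.factorial ((((-j).toNat + k : ℕ) + j).toNat))

open scoped Nat

/-- The `m`-th term of the series of `g_{b-a,p}`. -/
noncomputable def gjpTerm (a b : ℕ) (p x : ℝ) (m : ℕ) : ℝ :=
  p ^ (a + m) * x ^ (b + m) / ((a + m)! * (b + m)!)

/-- The `(k, m)` term of the double series obtained by applying `S_{n,b-a}` termwise to the series
of `g_{b-a,p}`, without the factor `s_{n,b+k}(x)`. -/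
noncomputable def momentTerm (a b : ℕ) (p n : ℝ) (k m : ℕ) : ℝ :=
  p ^ (a + m) / ((a + m)! * (b + m)!) * ((a + k + (b + m))! / ((a + k)! * n ^ (b + m)))

lemma add_choose_eq_sum_range (c k m : ℕ) :
    (c + m + k).choose m =
      ∑ r ∈ Finset.range (min m k + 1), (c + m).choose (m - r) * k.choose r := by
  rw [Nat.add_choose_eq, ← Finset.Nat.sum_antidiagonal_swap,
    Finset.Nat.sum_antidiagonal_eq_sum_range_succ_mk]
  symm
  apply Finset.sum_subset
  · intro r
    simp only [Finset.mem_range]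
    omega
  · intro r h1 h2
    simp only [Finset.mem_range] at h1 h2
    simp [Nat.choose_eq_zero_of_lt (show k < r by omega)]

lemma factorial_div_eq_sum_of_right_zero (a k m : ℕ) :
    ((a + k + m)! : ℝ) / ((a + k)! * m ! * (k ! * (a + m)!)) =
      ∑ r ∈ Finset.range (min m k + 1), 1 / ((a + r)! * r ! * (m - r)! * (k - r)! : ℝ) := by
  have h := congrArg (Nat.cast : ℕ → ℝ) (add_choose_eq_sum_range a k m)
  rw [Nat.cast_choose ℝ (by omega), show a + m + k - m = a + k by omega,
    show a + m + k = a + k + m by omega] at h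
  have h' : ((a + k + m)! : ℝ) / ((a + k)! * m ! * (k ! * (a + m)!)) =
      ((a + k + m)! / (m ! * (a + k)!)) / (k ! * (a + m)!) := by
    rw [div_div]
    ring
  rw [h', h]
  push_cast
  rw [Finset.sum_div]
  refine Finset.sum_congr rfl fun r hr => ?_
  simp only [Finset.mem_range] at hr
  rw [Nat.cast_choose ℝ (by omega), Nat.cast_choose ℝ (by omega),
    show a + m - (m - r) = a + r by omega]
  field_simp

lemma factorial_div_eq_sum {a b : ℕ} (hab : a = 0 ∨ b = 0) (k m : ℕ) :
    ((a + k + (b + m))! : ℝ) / ((a + k)! * (b + m)! * ((b + k)! * (a + m)!)) =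
      ∑ r ∈ Finset.range (min m k + 1),
        1 / ((a + r)! * (b + r)! * (m - r)! * (k - r)! : ℝ) := by
  rcases hab with rfl | rfl
  · have h := factorial_div_eq_sum_of_right_zero b m k
    rw [min_comm]
    convert h using 1
    · simp only [zero_add]
      rw [show k + (b + m) = b + m + k by omega]
      ring
    · refine Finset.sum_congr rfl fun r _ => ?_
      simp only [zero_add]
      ring
  · simpa using factorial_div_eq_sum_of_right_zero a k m

lemma summable_norm_gjpTerm (a b : ℕ) (p x : ℝ) : Summable fun m => ‖gjpTerm a b p x m‖ := by
  have h (c : ℕ) (y : ℝ) : Summable fun m => ‖y ^ (c + m) / ((c + m)! : ℝ)‖ :=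
    (Real.summable_pow_div_factorial y).norm.comp_injective (add_right_injective c)
  have hd : Function.Injective fun m : ℕ => (m, m) := fun _ _ h => (Prod.ext_iff.1 h).1
  refine (((h a p).mul_norm (h b x)).comp_injective hd).congr fun m => ?_
  simp only [Function.comp_apply, gjpTerm]
  rw [div_mul_div_comm]

lemma hasSum_real_mul {ι ι' : Type*} {f : ι → ℝ} {g : ι' → ℝ} {s t : ℝ} (hf : HasSum f s)
    (hg : HasSum g t) : HasSum (fun i : ι × ι' => f i.1 * g i.2) (s * t) :=
  hf.mul hg (summable_mul_of_summable_norm hf.summable.norm hg.summable.norm)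

lemma szk_mul_momentTerm_eq_sum {a b : ℕ} (hab : a = 0 ∨ b = 0) (p x : ℝ) {n : ℝ} (hn : 0 < n)
    (k m : ℕ) :
    szk n (b + k : ℕ) x * momentTerm a b p n k m =
      ∑ r ∈ Finset.range (min m k + 1),
        gjpTerm a b p x r * ((p / n) ^ (m - r) / ((m - r)! : ℝ) *
          ((n * x) ^ (k - r) / ((k - r)! : ℝ) * exp (-n * x))) := by
  have hS : szk n (b + k : ℕ) x * momentTerm a b p n k m =
      (n * x) ^ (b + k) * exp (-n * x) * (p ^ (a + m) / n ^ (b + m)) *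
      (((a + k + (b + m))! : ℝ) / ((a + k)! * (b + m)! * ((b + k)! * (a + m)!))) := by
    rw [szk, if_neg (by omega), Int.toNat_natCast, momentTerm]
    field_simp
  rw [hS, factorial_div_eq_sum hab, Finset.mul_sum]
  refine Finset.sum_congr rfl fun r hr => ?_
  simp only [Finset.mem_range] at hr
  obtain ⟨l, rfl⟩ := Nat.exists_eq_add_of_le (show r ≤ m by omega)
  obtain ⟨q, rfl⟩ := Nat.exists_eq_add_of_le (show r ≤ k by omega)
  simp only [gjpTerm, Nat.add_sub_cancel_left, div_pow]
  field_simp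
  ring

lemma hasSum_szk_mul_momentTerm {a b : ℕ} (hab : a = 0 ∨ b = 0) (p x : ℝ) {n : ℝ} (hn : 0 < n) :
    HasSum (fun km : ℕ × ℕ => szk n (b + km.1 : ℕ) x * momentTerm a b p n km.1 km.2)
      (exp (p / n) * ∑' m, gjpTerm a b p x m) := by
  have hexp (y : ℝ) : HasSum (fun l : ℕ => y ^ l / (l ! : ℝ)) (exp y) := by
    rw [Real.exp_eq_exp_ℝ]
    exact NormedSpace.expSeries_div_hasSum_exp y
  have hpois : HasSum (fun q : ℕ => (n * x) ^ q / (q ! : ℝ) * exp (-n * x)) 1 := by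
    convert! (hexp (n * x)).mul_right (exp (-n * x)) using 1
    rw [← Real.exp_add]
    simp
  have hrlq := hasSum_real_mul (summable_norm_gjpTerm a b p x).of_norm.hasSum
    (hasSum_real_mul (hexp (p / n)) hpois)
  let e : ℕ × ℕ × ℕ → (ℕ × ℕ) × ℕ := fun t => ((t.1 + t.2.2, t.1 + t.2.1), t.1)
  have he : Function.Injective e := by
    rintro ⟨r, l, q⟩ ⟨r', l', q'⟩ h
    simp only [e, Prod.mk.injEq] at h ⊢
    omega
  let F : (ℕ × ℕ) × ℕ → ℝ := fun t =>
    if t.2 ≤ t.1.1 ∧ t.2 ≤ t.1.2 then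
      gjpTerm a b p x t.2 * ((p / n) ^ (t.1.2 - t.2) / ((t.1.2 - t.2)! : ℝ) *
        ((n * x) ^ (t.1.1 - t.2) / ((t.1.1 - t.2)! : ℝ) * exp (-n * x)))
    else 0
  have hF : HasSum F ((∑' m, gjpTerm a b p x m) * (exp (p / n) * 1)) := by
    have hF0 (t : (ℕ × ℕ) × ℕ) (ht : t ∉ Set.range e) : F t = 0 := by
      obtain ⟨⟨k, m⟩, r⟩ := t
      simp only [F]
      rw [if_neg]
      rintro ⟨hk, hm⟩
      refine ht ⟨(r, m - r, k - r), ?_⟩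
      simp only [e, Nat.add_sub_cancel' hk, Nat.add_sub_cancel' hm]
    rw [← he.hasSum_iff hF0]
    convert! hrlq using 1
    ext ⟨r, l, q⟩
    simp [F, e]
  rw [mul_one, mul_comm] at hF
  have hfib (km : ℕ × ℕ) : HasSum (fun r => F (km, r))
      (szk n (b + km.1 : ℕ) x * momentTerm a b p n km.1 km.2) := by
    obtain ⟨k, m⟩ := km
    have hF0 (r : ℕ) (hr : r ∉ Finset.range (min m k + 1)) : F ((k, m), r) = 0 := by
      simp only [Finset.mem_range] at hr
      simp only [F]
      rw [if_neg (by omega)]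
    rw [szk_mul_momentTerm_eq_sum hab p x hn]
    have h := hasSum_sum_of_ne_finset_zero (L := .unconditional ℕ) hF0
    convert! h using 1
    refine Finset.sum_congr rfl fun r hr => ?_
    simp only [Finset.mem_range] at hr
    simp only [F]
    rw [if_pos (by omega)]
  exact hF.prod_fiberwise hfib

lemma summable_momentTerm {a b : ℕ} (hab : a = 0 ∨ b = 0) (p : ℝ) {n : ℝ} (hn : 0 < n) (k : ℕ) :
    Summable (momentTerm a b p n k) := by
  have h0 : szk n (b + k : ℕ) 1 ≠ 0 := by
    rw [szk, if_neg (by omega)]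
    positivity
  have h : Summable fun m => szk n (b + k : ℕ) 1 * momentTerm a b p n k m :=
    (hasSum_szk_mul_momentTerm hab p 1 hn).summable.prod_factor k
  generalize szk n (b + k : ℕ) 1 = c at h h0
  exact (summable_mul_left_iff h0).1 h

lemma integral_pow_mul_exp_neg_mul_Ioi {n : ℝ} (hn : 0 < n) (N : ℕ) :
    ∫ t in Set.Ioi (0 : ℝ), t ^ N * exp (-n * t) = N ! / n ^ (N + 1) := by
  have h := Real.integral_rpow_mul_exp_neg_mul_Ioi (a := N + 1) (by positivity) hn
  rw [Real.Gamma_nat_eq_factorial, ← Nat.cast_add_one, Real.rpow_natCast] at h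
  simp only [Nat.cast_add_one, add_sub_cancel_right, Real.rpow_natCast, ← neg_mul] at h
  rw [h, one_div, inv_pow]
  ring

lemma szk_mul_gjpTerm (a b : ℕ) (p n : ℝ) (k m : ℕ) (t : ℝ) :
    szk n (a + k : ℕ) t * gjpTerm a b p t m =
      n ^ (a + k) / (a + k)! * (p ^ (a + m) / ((a + m)! * (b + m)!)) *
        (t ^ (a + k + (b + m)) * exp (-n * t)) := by
  rw [szk, if_neg (by omega), Int.toNat_natCast, gjpTerm, mul_pow, pow_add t (a + k)]
  ring

lemma integrableOn_szk_mul_gjpTerm (a b : ℕ) (p : ℝ) {n : ℝ} (hn : 0 < n) (k m : ℕ) :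
    IntegrableOn (fun t => szk n (a + k : ℕ) t * gjpTerm a b p t m) (Set.Ioi 0) := by
  simp only [szk_mul_gjpTerm]
  refine Integrable.const_mul (Integrable.of_integral_ne_zero ?_) _
  rw [integral_pow_mul_exp_neg_mul_Ioi hn]
  positivity

lemma integral_szk_mul_gjpTerm (a b : ℕ) (p : ℝ) {n : ℝ} (hn : 0 < n) (k m : ℕ) :
    ∫ t in Set.Ioi (0 : ℝ), szk n (a + k : ℕ) t * gjpTerm a b p t m =
      momentTerm a b p n k m / n := by
  simp only [szk_mul_gjpTerm]
  rw [integral_const_mul, integral_pow_mul_exp_neg_mul_Ioi hn, momentTerm]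
  field_simp
  ring

lemma norm_szk_mul_gjpTerm (a b : ℕ) (p : ℝ) {n t : ℝ} (hn : 0 < n) (ht : 0 < t) (k m : ℕ) :
    ‖szk n (a + k : ℕ) t * gjpTerm a b p t m‖ =
      szk n (a + k : ℕ) t * gjpTerm a b |p| t m := by
  simp only [szk_mul_gjpTerm, Real.norm_eq_abs, abs_mul, abs_div, abs_pow, abs_of_pos hn,
    abs_of_pos ht, Nat.abs_cast, Real.abs_exp]

lemma hasSum_momentTerm {a b : ℕ} (hab : a = 0 ∨ b = 0) (p : ℝ) {n : ℝ} (hn : 0 < n) (k : ℕ) :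
    HasSum (momentTerm a b p n k)
      (n * ∫ t in Set.Ioi (0 : ℝ), szk n (a + k : ℕ) t * ∑' m, gjpTerm a b p t m) := by
  have h := hasSum_integral_of_summable_integral_norm
    (μ := volume.restrict (Set.Ioi (0 : ℝ)))
    (F := fun m t => szk n (a + k : ℕ) t * gjpTerm a b p t m)
    (fun m => integrableOn_szk_mul_gjpTerm a b p hn k m) ?_
  · simp only [integral_szk_mul_gjpTerm a b p hn, tsum_mul_left] at h
    convert! h.mul_left n using 2 with m
    field_simp
  · refine ((summable_momentTerm hab |p| hn k).div_const n).congr fun m => ?_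
    rw [← integral_szk_mul_gjpTerm a b |p| hn]
    exact setIntegral_congr_fun measurableSet_Ioi fun t ht =>
      (norm_szk_mul_gjpTerm a b p hn ht k m).symm

lemma gjp_eq_tsum_gjpTerm (j : ℤ) (p x : ℝ) :
    gjp j p x = ∑' m, gjpTerm (-j).toNat j.toNat p x m := by
  refine tsum_congr fun m => ?_
  rw [gjpTerm, show ((((-j).toNat + m : ℕ) : ℤ) + j).toNat = j.toNat + m by omega]

lemma gjp_zero_mul_sum_eq_zero (j : ℤ) (p n x : ℝ) :
    gjp j p 0 * ∑ k ∈ Finset.range j.toNat, szk n k x = 0 := by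
  rcases Nat.eq_zero_or_pos j.toNat with h | h
  · simp [h]
  · have h0 (m : ℕ) : gjpTerm (-j).toNat j.toNat p 0 m = 0 := by
      rw [gjpTerm, zero_pow (by omega), mul_zero, zero_div]
    simp [gjp_eq_tsum_gjpTerm, h0]

/-- `g_{j,p}` is an eigenfunction of `S_{n,j}` with eigenvalue `e^{p/n}`. -/
theorem eigenfunction_Snj (j : ℤ) (p : ℝ) (n : ℝ) (hn : 0 < n) :
    ∀ x ≥ (0:ℝ), Snj n j (gjp j p) x = Real.exp (p / n) * gjp j p x := by
  intro x _
  have hab : (-j).toNat = 0 ∨ j.toNat = 0 := by omega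
  rw [Snj, gjp_zero_mul_sum_eq_zero, zero_add, gjp_eq_tsum_gjpTerm j p x]
  refine ((hasSum_szk_mul_momentTerm hab p x hn).prod_fiberwise fun k => ?_).tsum_eq
  rw [show max 0 j + (k : ℤ) = (j.toNat + k : ℕ) by omega,
    show ((j.toNat + k : ℕ) : ℤ) - j = ((-j).toNat + k : ℕ) by omega]
  simp only [gjp_eq_tsum_gjpTerm]
  exact (hasSum_momentTerm hab p hn k).mul_left _
end

section
/- Let j ∈ ℤ and p > 0. Let y : ℂ → ℂ be twice complex-differentiable and satisfy the Bessel differential equation z² y″(z) + z y′(z) + (z² − j²) y(z) = 0 for all z ∈ ℂ. Define h : (0,∞) → ℂ by h(x) = (px)^{j/2} · y(2i√(px)), where (px)^{j/2} is the real power of the positive number px and √(px) is the real square root. Then h is an eigenfunction of D_j² with eigenvalue p, i.e., x h″(x) + (1−j) h′(x) = p h(x) for all x > 0. -/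
open MeasureTheory Real Filter Asymptotics

/-- Derivative of `x ↦ (px)^a g(2i√(px))` on the positive half-line. -/
theorem hasDerivAt_rpow_mul_comp_sqrt (a p : ℝ) (hp : 0 < p) {g : ℂ → ℂ}
    (hg : Differentiable ℂ g) {x : ℝ} (hx : 0 < x) :
    HasDerivAt
      (fun t : ℝ => (((p * t) ^ a : ℝ) : ℂ) * g (2 * Complex.I * (Real.sqrt (p * t) : ℂ)))
      ((((p * x) ^ a : ℝ) : ℂ) *
        (a * g (2 * Complex.I * (Real.sqrt (p * x) : ℂ)) +
          2 * Complex.I * (Real.sqrt (p * x) : ℂ) / 2 *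
            deriv g (2 * Complex.I * (Real.sqrt (p * x) : ℂ))) / x) x := by
  have hpx : 0 < p * x := mul_pos hp hx
  have hlin : HasDerivAt (fun t : ℝ => p * t) p x := by
    simpa using (hasDerivAt_id x).const_mul p
  have hpow : HasDerivAt (fun t : ℝ => (p * t) ^ a) ((p * x) ^ a * a / x) x := by
    convert hlin.rpow_const (p := a) (Or.inl hpx.ne') using 1
    rw [Real.rpow_sub_one hpx.ne']
    field_simp
  have hsqrt : HasDerivAt (fun t : ℝ => Real.sqrt (p * t)) (Real.sqrt (p * x) / (2 * x)) x := by
    convert hlin.sqrt hpx.ne' using 1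
    have hs := Real.sqrt_pos.2 hpx
    have hsq := Real.sq_sqrt hpx.le
    rw [div_eq_div_iff (by positivity) (by positivity)]
    linear_combination 2 * hsq
  have hz : HasDerivAt (fun t : ℝ => 2 * Complex.I * (Real.sqrt (p * t) : ℂ))
      (2 * Complex.I * ((Real.sqrt (p * x) / (2 * x) : ℝ) : ℂ)) x :=
    hsqrt.ofReal_comp.const_mul _
  have hcomp := (hg (2 * Complex.I * (Real.sqrt (p * x) : ℂ))).hasDerivAt.comp x hz
  have hx' : (x : ℂ) ≠ 0 := by exact_mod_cast hx.ne'
  refine (hpow.ofReal_comp.mul hcomp).congr_deriv ?_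
  simp only [Function.comp_apply]
  push_cast
  field_simp

/-- Solutions of the Bessel differential equation give eigenfunctions of `D_j²`. -/
theorem bessel_eigenfunction_D2 (j : ℤ) (p : ℝ) (hp : 0 < p) (y : ℂ → ℂ)
    (hy1 : Differentiable ℂ y) (hy2 : Differentiable ℂ (deriv y))
    (hODE : ∀ z : ℂ, z ^ 2 * deriv (deriv y) z + z * deriv y z + (z ^ 2 - (j : ℂ) ^ 2) * y z = 0)
    (h : ℝ → ℂ)
    (hh : ∀ x : ℝ,
      h x = (((p * x) ^ ((j : ℝ) / 2) : ℝ) : ℂ) * y (2 * Complex.I * (Real.sqrt (p * x) : ℂ))) :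
    ∀ x > (0:ℝ), (x : ℂ) * deriv (deriv h) x + (1 - (j : ℂ)) * deriv h x = (p : ℂ) * h x := by
  intro x hx
  have hh' : h = fun t : ℝ => (((p * t) ^ ((j : ℝ) / 2) : ℝ) : ℂ) *
      y (2 * Complex.I * (Real.sqrt (p * t) : ℂ)) := funext hh
  have hx' : (x : ℂ) ≠ 0 := by exact_mod_cast hx.ne'
  set g : ℂ → ℂ := fun w => (((j : ℝ) / 2 : ℝ) : ℂ) * y w + w / 2 * deriv y w with hg
  have hgd : ∀ w, HasDerivAt g ((((j : ℝ) / 2 : ℝ) : ℂ) * deriv y w +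
      (1 / 2 * deriv y w + w / 2 * deriv (deriv y) w)) w := fun w =>
    ((hy1 w).hasDerivAt.const_mul _).add
      (((hasDerivAt_id w).div_const 2).mul (hy2 w).hasDerivAt)
  have hderiv : ∀ t > (0 : ℝ), deriv h t = (((p * t) ^ ((j : ℝ) / 2) : ℝ) : ℂ) *
      g (2 * Complex.I * (Real.sqrt (p * t) : ℂ)) / t := fun t ht => by
    rw [hh']
    exact (hasDerivAt_rpow_mul_comp_sqrt _ p hp hy1 ht).deriv
  have hderiv2 := (((hasDerivAt_rpow_mul_comp_sqrt ((j : ℝ) / 2) p hp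
    (fun w => (hgd w).differentiableAt) hx).div
    (hasDerivAt_id x).ofReal_comp hx').congr_of_eventuallyEq
    (Filter.eventually_of_mem (Ioi_mem_nhds hx) hderiv)).deriv
  rw [hderiv2, hderiv x hx, hh x, (hgd _).deriv]
  have hz : (2 * Complex.I * (Real.sqrt (p * x) : ℂ)) ^ 2 = -4 * (p * x) := by
    have hs : (Real.sqrt (p * x) : ℂ) ^ 2 = p * x := by
      exact_mod_cast Real.sq_sqrt (mul_pos hp hx).le
    rw [mul_pow, mul_pow, hs, Complex.I_sq]
    ring
  have hode := hODE (2 * Complex.I * (Real.sqrt (p * x) : ℂ))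
  simp only [hg]
  generalize 2 * Complex.I * (Real.sqrt (p * x) : ℂ) = z at *
  generalize (((p * x) ^ ((j : ℝ) / 2) : ℝ) : ℂ) = u
  simp only [id]
  push_cast
  field_simp
  linear_combination u * hode - u * y z * hz
end

section
/- Let j ∈ ℤ, A ≥ 0 and p ∈ ℝ. Let h : [0,∞) → ℝ with h ∈ E_A be twice continuously differentiable on (0,∞), and suppose that S_{n,j} h = e^{p/n} h holds for infinitely many integers n. Then h is an eigenfunction of D_j² with eigenvalue p: (1−j) h′(x) + x h″(x) = p h(x) for all x > 0. -/
open MeasureTheory Real Filter Asymptotics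

lemma szk_natCast (n : ℝ) (k : ℕ) (x : ℝ) :
    szk n k x = (n * x) ^ k / k.factorial * rexp (-n * x) := by
  simp [szk]

lemma szk_natCast_nonneg {n : ℝ} (hn : 0 ≤ n) (k : ℕ) {x : ℝ} (hx : 0 ≤ x) : 0 ≤ szk n k x := by
  rw [szk_natCast]
  positivity

lemma Snj_eq (n : ℝ) (j : ℤ) (f : ℝ → ℝ) (x : ℝ) :
    Snj n j f x = f 0 * ∑ k ∈ Finset.range j.toNat, szk n k x
      + ∑' k : ℕ, szk n ((k + j.toNat : ℕ) : ℤ) x *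
        (n * ∫ t in Set.Ioi (0 : ℝ), szk n ((k + (-j).toNat : ℕ) : ℤ) t * f t) := by
  have h₁ (k : ℕ) : max 0 j + k = ((k + j.toNat : ℕ) : ℤ) := by omega
  have h₂ (k : ℕ) : ((k + j.toNat : ℕ) : ℤ) - j = ((k + (-j).toNat : ℕ) : ℤ) := by omega
  simp only [Snj, h₁, h₂]

lemma MemEA.mono {A B : ℝ} {f : ℝ → ℝ} (hf : MemEA A f) (hAB : A ≤ B) : MemEA B f := by
  obtain ⟨hloc, K, hK, hb⟩ := hf
  refine ⟨hloc, K, hK, fun t ht => (hb t ht).trans ?_⟩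
  gcongr

lemma MemEA.add {A : ℝ} {f g : ℝ → ℝ} (hf : MemEA A f) (hg : MemEA A g) :
    MemEA A (fun t => f t + g t) := by
  obtain ⟨hf, K, hK, hfb⟩ := hf
  obtain ⟨hg, L, hL, hgb⟩ := hg
  refine ⟨hf.add hg, K + L, by positivity, fun t ht => (abs_add_le _ _).trans ?_⟩
  linarith [hfb t ht, hgb t ht]

lemma MemEA.const_mul {A : ℝ} {f : ℝ → ℝ} (hf : MemEA A f) (c : ℝ) :
    MemEA A (fun t => c * f t) := by
  obtain ⟨hf, K, hK, hfb⟩ := hf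
  refine ⟨hf.smul c, (|c| + 1) * K, by positivity, fun t ht => ?_⟩
  rw [abs_mul, mul_assoc]
  have := hfb t ht
  gcongr
  linarith

lemma memEA_exp (a : ℝ) : MemEA a (fun t => rexp (a * t)) :=
  ⟨ContinuousOn.locallyIntegrableOn (by fun_prop) measurableSet_Ici, 1, one_pos, fun t _ => by
    rw [abs_of_pos (exp_pos _), one_mul]⟩

lemma memEA_eval_exp (q : Polynomial ℝ) {B : ℝ} (hB : q.natDegree ≤ B) :
    MemEA B (fun t => q.eval (rexp t)) := by
  refine ⟨ContinuousOn.locallyIntegrableOn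
    (q.continuous.comp continuous_exp).continuousOn measurableSet_Ici,
    ∑ i ∈ Finset.range (q.natDegree + 1), |q.coeff i| + 1, by positivity, fun t ht => ?_⟩
  simp only [Polynomial.eval_eq_sum_range]
  rw [add_mul, Finset.sum_mul]
  refine (Finset.abs_sum_le_sum_abs _ _).trans (le_add_of_le_of_nonneg ?_ (by positivity))
  refine Finset.sum_le_sum fun i hi => ?_
  rw [abs_mul, ← exp_nat_mul, abs_of_pos (exp_pos _)]
  have : (i : ℝ) ≤ B := le_trans (by exact_mod_cast Finset.mem_range_succ_iff.1 hi) hB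
  gcongr

lemma integral_szk_mul_exp {n a : ℝ} (hn : 0 < n) (ha : a < n) (m : ℕ) :
    IntegrableOn (fun t => szk n m t * rexp (a * t)) (Set.Ioi 0) ∧
      n * ∫ t in Set.Ioi (0 : ℝ), szk n m t * rexp (a * t) = (n / (n - a)) ^ (m + 1) := by
  have hna : 0 < n - a := sub_pos.2 ha
  have key : ∫ t in Set.Ioi (0 : ℝ), szk n m t * rexp (a * t)
      = n ^ m / m.factorial * ((1 / (n - a)) ^ (m + 1) * m.factorial) := by
    rw [← Real.Gamma_nat_eq_factorial m]
    have := integral_rpow_mul_exp_neg_mul_Ioi (a := (m : ℝ) + 1) (by positivity) hna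
    rw [← Nat.cast_add_one, rpow_natCast, Nat.cast_add_one] at this
    rw [← this, ← integral_const_mul]
    refine integral_congr_ae (Eventually.of_forall fun t => ?_)
    simp only [szk_natCast, add_sub_cancel_right, rpow_natCast, Real.Gamma_nat_eq_factorial]
    rw [show -((n - a) * t) = -n * t + a * t by ring, exp_add]
    ring
  refine ⟨?_, ?_⟩
  · by_contra hni
    rw [integral_undef hni] at key
    have : 0 < n ^ m / m.factorial * ((1 / (n - a)) ^ (m + 1) * m.factorial) := by positivity
    linarith
  · rw [key, div_pow, div_pow]
    field_simp
    ring

lemma MemEA.integrableOn_szk_mul {A n : ℝ} {f : ℝ → ℝ} (hf : MemEA A f) (hn : 0 < n)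
    (hA : A < n) (m : ℕ) : IntegrableOn (fun t => szk n m t * f t) (Set.Ioi 0) := by
  obtain ⟨hloc, K, hK, hb⟩ := hf
  refine Integrable.mono' ((integral_szk_mul_exp hn hA m).1.const_mul K) ?_ ?_
  · refine AEStronglyMeasurable.mul ?_
      (hloc.mono_set Set.Ioi_subset_Ici_self).aestronglyMeasurable
    refine Continuous.aestronglyMeasurable ?_
    rw [show szk n m = fun t => (n * t) ^ m / m.factorial * rexp (-n * t) from
      funext (szk_natCast n m)]
    fun_prop
  · refine (ae_restrict_iff' measurableSet_Ioi).2 (Eventually.of_forall fun t ht => ?_)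
    have h₀ := szk_natCast_nonneg hn.le m (Set.mem_Ioi.1 ht).le
    rw [norm_mul, norm_of_nonneg h₀, norm_eq_abs, mul_left_comm]
    exact mul_le_mul_of_nonneg_left (hb t (Set.mem_Ioi.1 ht).le) h₀

lemma hasSum_szk_mul_pow (n x r : ℝ) :
    HasSum (fun k : ℕ => szk n k x * r ^ k) (rexp (n * x * (r - 1))) := by
  have := (NormedSpace.expSeries_div_hasSum_exp (n * x * r)).mul_right (rexp (-n * x))
  rw [← exp_eq_exp_ℝ, ← exp_add] at this
  rw [show n * x * (r - 1) = n * x * r + -n * x by ring]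
  refine this.congr_fun fun k => ?_
  rw [szk_natCast, mul_pow (n * x)]
  ring

lemma integral_szk_mul_le {A n K : ℝ} {f : ℝ → ℝ} (hn : 0 < n)
    (hA : A < n) (hb : ∀ t ≥ (0 : ℝ), |f t| ≤ K * rexp (A * t)) (m : ℕ) :
    |n * ∫ t in Set.Ioi (0 : ℝ), szk n m t * f t| ≤ K * (n / (n - A)) ^ (m + 1) := by
  obtain ⟨hint, hval⟩ := integral_szk_mul_exp hn hA m
  rw [abs_mul, abs_of_pos hn, ← hval, mul_left_comm, ← integral_const_mul]
  refine mul_le_mul_of_nonneg_left ?_ hn.le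
  rw [← norm_eq_abs]
  refine norm_integral_le_of_norm_le (hint.const_mul K) ?_
  refine (ae_restrict_iff' measurableSet_Ioi).2 (Eventually.of_forall fun t ht => ?_)
  have h₀ := szk_natCast_nonneg hn.le m (Set.mem_Ioi.1 ht).le
  rw [norm_mul, norm_of_nonneg h₀, norm_eq_abs, mul_left_comm]
  exact mul_le_mul_of_nonneg_left (hb t (Set.mem_Ioi.1 ht).le) h₀

lemma MemEA.summable_Snj {A n x : ℝ} {f : ℝ → ℝ} (hf : MemEA A f) (hn : 0 < n)
    (hA : A < n) (hx : 0 ≤ x) (i l : ℕ) :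
    Summable fun k : ℕ => szk n ((k + i : ℕ) : ℤ) x *
        (n * ∫ t in Set.Ioi (0 : ℝ), szk n ((k + l : ℕ) : ℤ) t * f t) := by
  obtain ⟨-, K, hK, hb⟩ := hf
  have hr : 0 < n / (n - A) := div_pos hn (sub_pos.2 hA)
  have hs := ((summable_nat_add_iff i).2 (hasSum_szk_mul_pow n x (n / (n - A))).summable).mul_left
    (K * (n / (n - A)) ^ ((l : ℤ) + 1 - i))
  refine Summable.of_norm_bounded hs fun k => ?_
  rw [norm_mul, norm_of_nonneg (szk_natCast_nonneg hn.le _ hx)]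
  refine (mul_le_mul_of_nonneg_left (integral_szk_mul_le hn hA hb _)
    (szk_natCast_nonneg hn.le _ hx)).trans_eq ?_
  rw [← zpow_natCast (n / (n - A)) (k + l + 1), ← zpow_natCast (n / (n - A)) (k + i),
    show (((k + l + 1 : ℕ)) : ℤ) = ((l : ℤ) + 1 - i) + ((k + i : ℕ) : ℤ) by push_cast; ring,
    zpow_add₀ hr.ne']
  ring

lemma Snj_add {A n x : ℝ} {f g : ℝ → ℝ} (hf : MemEA A f) (hg : MemEA A g) (hn : 0 < n)
    (hA : A < n) (hx : 0 ≤ x) (j : ℤ) :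
    Snj n j (fun t => f t + g t) x = Snj n j f x + Snj n j g x := by
  simp only [Snj_eq, mul_add]
  simp_rw [integral_add (hf.integrableOn_szk_mul hn hA _) (hg.integrableOn_szk_mul hn hA _),
    mul_add]
  rw [(hf.summable_Snj hn hA hx _ _).tsum_add (hg.summable_Snj hn hA hx _ _)]
  ring

lemma Snj_const_mul (n : ℝ) (j : ℤ) (c : ℝ) (f : ℝ → ℝ) (x : ℝ) :
    Snj n j (fun t => c * f t) x = c * Snj n j f x := by
  simp only [Snj_eq, mul_left_comm _ c, integral_const_mul, tsum_mul_left]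
  ring

lemma abs_Snj_le {A n x : ℝ} {f g : ℝ → ℝ} (hg : MemEA A g)
    (hfg : ∀ t ≥ (0 : ℝ), |f t| ≤ g t) (hn : 0 < n) (hA : A < n) (hx : 0 ≤ x) (j : ℤ) :
    |Snj n j f x| ≤ Snj n j g x := by
  rw [Snj_eq, Snj_eq]
  have hpos (k : ℕ) := szk_natCast_nonneg hn.le k hx
  refine (abs_add_le _ _).trans (add_le_add ?_ ?_)
  · rw [abs_mul, abs_of_nonneg (Finset.sum_nonneg fun k _ => hpos k)]
    exact mul_le_mul_of_nonneg_right (hfg 0 le_rfl) (Finset.sum_nonneg fun k _ => hpos k)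
  · rw [← norm_eq_abs]
    refine tsum_of_norm_bounded (hg.summable_Snj hn hA hx _ _).hasSum fun k => ?_
    rw [norm_mul, norm_of_nonneg (hpos _), norm_mul n, norm_of_nonneg hn.le]
    refine mul_le_mul_of_nonneg_left (mul_le_mul_of_nonneg_left ?_ hn.le) (hpos _)
    refine norm_integral_le_of_norm_le (hg.integrableOn_szk_mul hn hA _) ?_
    refine (ae_restrict_iff' measurableSet_Ioi).2 (Eventually.of_forall fun t ht => ?_)
    have h₀ := szk_natCast_nonneg hn.le (k + (-j).toNat) (Set.mem_Ioi.1 ht).le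
    rw [norm_mul, norm_of_nonneg h₀]
    exact mul_le_mul_of_nonneg_left (hfg t (Set.mem_Ioi.1 ht).le) h₀

lemma Snj_exp {n a x : ℝ} (hn : 0 < n) (ha : a < n) (j : ℤ) :
    Snj n j (fun t => rexp (a * t)) x
      = (n / (n - a)) ^ (1 - j) * rexp (n * x * (n / (n - a) - 1))
        + ∑ k ∈ Finset.range j.toNat,
          szk n k x * (1 - (n / (n - a)) ^ (1 - j) * (n / (n - a)) ^ k) := by
  rw [Snj_eq]
  have hr : 0 < n / (n - a) := div_pos hn (sub_pos.2 ha)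
  simp_rw [(integral_szk_mul_exp hn ha _).2]
  set r := n / (n - a)
  have hterm (k : ℕ) : szk n ((k + j.toNat : ℕ) : ℤ) x * r ^ (k + (-j).toNat + 1)
      = r ^ (1 - j) * (szk n ((k + j.toNat : ℕ) : ℤ) x * r ^ (k + j.toNat)) := by
    rw [← zpow_natCast r (k + (-j).toNat + 1), ← zpow_natCast r (k + j.toNat),
      show ((k + (-j).toNat + 1 : ℕ) : ℤ) = (1 - j) + ((k + j.toNat : ℕ) : ℤ) by omega,
      zpow_add₀ hr.ne']
    ring
  have hsum := hasSum_szk_mul_pow n x r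
  simp_rw [hterm]
  rw [tsum_mul_left, ← hsum.tsum_eq, ← hsum.summable.sum_add_tsum_nat_add j.toNat, mul_add,
    Finset.mul_sum, Finset.mul_sum]
  simp only [mul_zero, exp_zero, one_mul, mul_sub, mul_one, Finset.sum_sub_distrib]
  simp only [mul_left_comm]
  ring

lemma tendsto_natCast_mul_szk {x : ℝ} (hx : 0 < x) (k : ℕ) :
    Tendsto (fun n : ℕ => n * szk n k x) atTop (nhds 0) := by
  have h₁ : Tendsto (fun n : ℕ => (n : ℝ) * x) atTop atTop :=
    tendsto_natCast_atTop_atTop.atTop_mul_const hx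
  have h₂ := ((tendsto_pow_mul_exp_neg_atTop_nhds_zero (k + 1)).comp h₁).const_mul
    (1 / (x * k.factorial))
  rw [mul_zero] at h₂
  refine h₂.congr fun n => ?_
  simp only [Function.comp_apply, szk_natCast, neg_mul]
  field_simp
  ring

lemma tendsto_div_natCast_sub (a : ℝ) :
    Tendsto (fun n : ℕ => (n : ℝ) / (n - a)) atTop (nhds 1) := by
  have h₁ : Tendsto (fun n : ℕ => (1 - a * (n : ℝ)⁻¹)⁻¹) atTop (nhds (1 - a * 0)⁻¹) :=
    ((tendsto_inv_atTop_nhds_zero_nat.const_mul a).const_sub 1).inv₀ (by simp)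
  rw [mul_zero, sub_zero, inv_one] at h₁
  refine h₁.congr' ?_
  filter_upwards [eventually_gt_atTop 0] with n hn
  have : (0 : ℝ) < n := by exact_mod_cast hn
  rw [show (n : ℝ) - a = n * (1 - a * (n : ℝ)⁻¹) by field_simp, div_mul_eq_div_div,
    div_self this.ne', one_div]

lemma tendsto_Snj_exp (j : ℤ) (a : ℝ) {x : ℝ} (hx : 0 < x) :
    Tendsto (fun n : ℕ => n * (Snj n j (fun t => rexp (a * t)) x - rexp (a * x))) atTop
      (nhds (((1 - j) * a + a ^ 2 * x) * rexp (a * x))) := by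
  have htail : Tendsto (fun n : ℕ => ∑ k ∈ Finset.range j.toNat, n * szk n k x *
      (1 - ((n : ℝ) / (n - a)) ^ (1 - j) * ((n : ℝ) / (n - a)) ^ k)) atTop (nhds 0) := by
    have hr := tendsto_div_natCast_sub a
    have := tendsto_finsetSum (Finset.range j.toNat) fun k _ =>
      (tendsto_natCast_mul_szk hx k).mul
        (((hr.zpow₀ (1 - j) (Or.inl one_ne_zero)).mul (hr.pow k)).const_sub 1)
    simpa using this
  have hderiv : HasDerivAt
      (fun u : ℝ => ((1 - a * u)⁻¹) ^ (1 - j) * rexp (a * x * (1 - a * u)⁻¹))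
      (((1 - j) * a + a ^ 2 * x) * rexp (a * x)) 0 := by
    have h₁ : HasDerivAt (fun u : ℝ => (1 - a * u)⁻¹) a 0 := by
      have := (((hasDerivAt_id (0 : ℝ)).const_mul a).const_sub 1).fun_inv (by simp)
      simpa using this
    have h₂ : HasDerivAt (fun r : ℝ => r ^ (1 - j) * rexp (a * x * r))
        ((1 - j) * rexp (a * x) + a * x * rexp (a * x)) ((1 - a * 0)⁻¹) := by
      have := (hasDerivAt_zpow (1 - j) (1 : ℝ) (Or.inl one_ne_zero)).mul
        ((hasDerivAt_id (1 : ℝ)).const_mul (a * x)).exp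
      simp only [mul_zero, sub_zero, inv_one]
      refine this.congr_deriv ?_
      simp
      ring
    refine (h₂.comp 0 h₁).congr_deriv ?_
    ring
  have hmain := (hasDerivAt_iff_tendsto_slope_zero.1 hderiv).comp
    ((tendsto_inv_atTop_nhdsGT_zero.mono_right
      (nhdsWithin_mono 0 fun u (hu : 0 < u) => hu.ne')).comp
      (tendsto_natCast_atTop_atTop (R := ℝ)))
  have := hmain.add htail
  rw [add_zero] at this
  refine this.congr' ?_
  filter_upwards [eventually_gt_atTop 0,
    tendsto_natCast_atTop_atTop.eventually (eventually_gt_atTop a)] with n hn hna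
  have hn' : (0 : ℝ) < n := by exact_mod_cast hn
  have hna' : (n : ℝ) - a ≠ 0 := (sub_pos.2 hna).ne'
  have hr : (1 - a * (n : ℝ)⁻¹)⁻¹ = n / (n - a) := by
    rw [show 1 - a * (n : ℝ)⁻¹ = (n - a) / n by field_simp, inv_div]
  have he : a * x * ((n : ℝ) / (n - a)) = n * x * (n / (n - a) - 1) := by
    field_simp
    ring
  simp only [Function.comp_apply, zero_add, smul_eq_mul, inv_inv, hr, he, mul_zero, sub_zero,
    inv_one, one_zpow, mul_one, one_mul]
  rw [Snj_exp hn' hna, ← he, he]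
  simp only [mul_assoc, ← Finset.mul_sum]
  ring

lemma tendsto_Snj_eval_exp (j : ℤ) {x : ℝ} (hx : 0 < x) (q : Polynomial ℝ) :
    Tendsto (fun n : ℕ => n * (Snj n j (fun t => q.eval (rexp t)) x - q.eval (rexp x))) atTop
      (nhds ((1 - j) * (rexp x * q.derivative.eval (rexp x))
        + x * (rexp x * q.derivative.eval (rexp x)
          + rexp x ^ 2 * q.derivative.derivative.eval (rexp x)))) := by
  induction q using Polynomial.induction_on' with
  | add p q hp hq =>
    have hB (r : Polynomial ℝ) (hr : r.natDegree ≤ max p.natDegree q.natDegree) :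
        MemEA (max p.natDegree q.natDegree : ℕ) (fun t => r.eval (rexp t)) :=
      memEA_eval_exp r (by exact_mod_cast hr)
    have := hp.add hq
    simp only [Polynomial.derivative_add, Polynomial.eval_add]
    refine (this.congr' ?_).trans_eq ?_
    · filter_upwards [eventually_gt_atTop (max p.natDegree q.natDegree)] with n hn
      rw [Snj_add (hB p (le_max_left _ _)) (hB q (le_max_right _ _))
        (by exact_mod_cast (Nat.zero_le _).trans_lt hn) (by exact_mod_cast hn) hx.le]
      ring
    · congr 1
      ring
  | monomial m c =>
    have := (tendsto_Snj_exp j m hx).const_mul c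
    have he (t : ℝ) : (Polynomial.monomial m c).eval (rexp t) = c * rexp (m * t) := by
      rw [Polynomial.eval_monomial, exp_nat_mul]
    simp only [he, Snj_const_mul]
    refine (this.congr fun n => by ring).trans_eq ?_
    congr 1
    simp only [Polynomial.derivative_monomial, Polynomial.eval_monomial, exp_nat_mul]
    rcases m with _ | _ | m
    · simp
    · simp
      ring
    · simp only [Nat.add_sub_cancel]
      push_cast
      ring

lemma abs_sub_le_abs_exp_sub {s t : ℝ} (hs : 0 ≤ s) (ht : 0 ≤ t) :
    |t - s| ≤ |rexp t - rexp s| := by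
  wlog hst : s ≤ t generalizing s t
  · rw [abs_sub_comm t, abs_sub_comm (rexp t)]
    exact this ht hs (le_of_not_ge hst)
  rw [abs_of_nonneg (sub_nonneg.2 hst), abs_of_nonneg (sub_nonneg.2 (exp_le_exp.2 hst))]
  have h₁ : rexp t = rexp s * rexp (t - s) := by rw [← exp_add]; ring_nf
  have h₂ := add_one_le_exp (t - s)
  have h₃ := one_le_exp hs
  nlinarith

lemma tendsto_Snj_of_isLittleO (j : ℤ) {A x : ℝ} (hx : 0 < x) {f : ℝ → ℝ} (hf : MemEA A f)
    (hfx : f =o[nhds x] fun t => (t - x) ^ 2) :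
    Tendsto (fun n : ℕ => n * Snj n j f x) atTop (nhds 0) := by
  obtain ⟨-, K, hK, hb⟩ := hf
  set y := rexp x with hy
  obtain ⟨N, hN⟩ := exists_nat_ge A
  rw [Metric.tendsto_nhds]
  intro η hη
  set ε := η / (2 * x * y ^ 2 + 1) with hε
  have hε₀ : 0 < ε := by positivity
  obtain ⟨δ, hδ, hnear⟩ := Metric.eventually_nhds_iff.1 (hfx.bound hε₀)
  set C := K * (1 + y / δ) ^ (2 * (N + 2)) with hC
  set Q : Polynomial ℝ := Polynomial.C ε * (Polynomial.X - Polynomial.C y) ^ 2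
    + Polynomial.C C * (Polynomial.X - Polynomial.C y) ^ (2 * (N + 2)) with hQ
  have hfQ : ∀ t ≥ (0 : ℝ), |f t| ≤ Q.eval (rexp t) := by
    intro t ht
    have hdist := abs_sub_le_abs_exp_sub hx.le ht
    have hQt : Q.eval (rexp t) = ε * (rexp t - y) ^ 2 + C * (rexp t - y) ^ (2 * (N + 2)) := by
      simp [hQ]
    have hsq : (rexp t - y) ^ (2 * (N + 2)) = |rexp t - y| ^ (2 * (N + 2)) :=
      (Even.pow_abs (even_two_mul _) _).symm
    rw [hQt, hsq]
    rcases lt_or_ge (dist t x) δ with hlt | hge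
    · have h₁ := hnear hlt
      rw [norm_eq_abs, norm_of_nonneg (sq_nonneg _)] at h₁
      have h₂ : (t - x) ^ 2 ≤ (rexp t - y) ^ 2 := sq_le_sq.2 hdist
      have h₃ : 0 ≤ C * |rexp t - y| ^ (2 * (N + 2)) := by positivity
      nlinarith
    · have h₁ : δ ≤ |rexp t - y| := by
        rw [Real.dist_eq] at hge
        exact hge.trans hdist
      have h₂ : rexp t ≤ (1 + y / δ) * |rexp t - y| := by
        have h₃ : y / δ * δ ≤ y / δ * |rexp t - y| := by gcongr
        rw [div_mul_cancel₀ _ hδ.ne'] at h₃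
        linarith [le_abs_self (rexp t - y)]
      have h₄ : rexp (A * t) ≤ rexp t ^ (2 * (N + 2)) := by
        rw [← exp_nat_mul]
        gcongr
        push_cast
        linarith
      calc |f t| ≤ K * rexp (A * t) := hb t ht
        _ ≤ K * rexp t ^ (2 * (N + 2)) := by gcongr
        _ ≤ K * ((1 + y / δ) * |rexp t - y|) ^ (2 * (N + 2)) := by gcongr
        _ = C * |rexp t - y| ^ (2 * (N + 2)) := by rw [mul_pow, hC, mul_assoc]
        _ ≤ _ := le_add_of_nonneg_left (by positivity)
  have hlim := tendsto_Snj_eval_exp j hx Q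
  rw [← hy] at hlim
  have hQ₀ : Q.eval y = 0 := by simp [hQ]
  have hQ₁ : Q.derivative.eval y = 0 := by
    simp [hQ, Polynomial.derivative_pow, show 2 * (N + 2) - 1 = 2 * N + 3 by omega]
  have hQ₂ : Q.derivative.derivative.eval y = 2 * ε := by
    simp [hQ, Polynomial.derivative_pow, show 2 * (N + 2) - 1 = 2 * N + 3 by omega]
    ring
  rw [hQ₀, hQ₁, hQ₂] at hlim
  have hlt : (1 - (j : ℝ)) * (y * 0) + x * (y * 0 + y ^ 2 * (2 * ε)) < η := by
    have : η = ε * (2 * x * y ^ 2 + 1) := by rw [hε]; field_simp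
    rw [this]
    linarith
  filter_upwards [hlim.eventually (gt_mem_nhds hlt), eventually_gt_atTop Q.natDegree] with n hn hnQ
  have hn₀ : (0 : ℝ) < n := by exact_mod_cast (Nat.zero_le _).trans_lt hnQ
  have := abs_Snj_le (memEA_eval_exp Q le_rfl) hfQ hn₀ (by exact_mod_cast hnQ) hx.le j
  rw [Real.dist_eq, sub_zero, abs_mul, abs_of_pos hn₀]
  rw [sub_zero] at hn
  exact (mul_le_mul_of_nonneg_left this hn₀.le).trans_lt hn

lemma isLittleO_of_contDiffOn {f : ℝ → ℝ} {x : ℝ} {s : Set ℝ} (hs : Convex ℝ s) (hso : IsOpen s)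
    (hx : x ∈ s) (hf : ContDiffOn ℝ 2 f s) (h₀ : f x = 0) (h₁ : deriv f x = 0)
    (h₂ : deriv (deriv f) x = 0) : f =o[nhds x] fun t => (t - x) ^ 2 := by
  have := taylor_isLittleO (n := 2) hs hx (by exact_mod_cast hf)
  rw [hso.nhdsWithin_eq hx] at this
  simpa [taylorWithinEval_succ, taylor_within_zero_eval, iteratedDerivWithin_of_isOpen hso hx,
    iteratedDeriv_succ, iteratedDeriv_zero, h₀, h₁, h₂] using this

/-- The Voronovskaja relation for `S_{n,j}`. -/
lemma tendsto_Snj_voronovskaja (j : ℤ) {A x : ℝ} (hx : 0 < x) {h : ℝ → ℝ} (hE : MemEA A h)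
    (hC2 : ContDiffOn ℝ 2 h (Set.Ioi 0)) :
    Tendsto (fun n : ℕ => n * (Snj n j h x - h x)) atTop
      (nhds ((1 - j) * deriv h x + x * deriv (deriv h) x)) := by
  set y := rexp x with hy
  have hy₀ : y ≠ 0 := (exp_pos x).ne'
  set α := deriv h x / y with hα
  set β := (deriv (deriv h) x - deriv h x) / (2 * y ^ 2) with hβ
  set P : Polynomial ℝ := Polynomial.C (h x) + Polynomial.C α * (Polynomial.X - Polynomial.C y)
    + Polynomial.C β * (Polynomial.X - Polynomial.C y) ^ 2 with hP
  have hP₀ : P.eval y = h x := by simp [hP]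
  have hP₁ : P.derivative.eval y = α := by simp [hP, Polynomial.derivative_pow]
  have hP₂ : P.derivative.derivative.eval y = 2 * β := by
    simp [hP, Polynomial.derivative_pow]
    ring
  have hdP (q : Polynomial ℝ) (t : ℝ) :
      HasDerivAt (fun t => q.eval (rexp t)) (q.derivative.eval (rexp t) * rexp t) t :=
    (q.hasDerivAt (rexp t)).comp t (hasDerivAt_exp t)
  set f : ℝ → ℝ := fun t => h t + -1 * P.eval (rexp t) with hf
  have hdh {t : ℝ} (ht : 0 < t) : DifferentiableAt ℝ h t :=
    (hC2.differentiableOn two_ne_zero).differentiableAt (Ioi_mem_nhds ht)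
  have hdh' : DifferentiableAt ℝ (deriv h) x :=
    ((hC2.deriv_of_isOpen (m := 1) isOpen_Ioi (by norm_num)).differentiableOn
      one_ne_zero).differentiableAt (Ioi_mem_nhds hx)
  have hdf {t : ℝ} (ht : 0 < t) :
      deriv f t = deriv h t + -1 * (P.derivative.eval (rexp t) * rexp t) :=
    ((hdh ht).hasDerivAt.add ((hdP P t).const_mul (-1))).deriv
  have hdf' : deriv (deriv f) x = deriv (deriv h) x
      + -1 * (P.derivative.derivative.eval y * y * y + P.derivative.eval y * y) := by
    have heq : deriv f =ᶠ[nhds x]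
        fun t => deriv h t + -1 * (P.derivative.eval (rexp t) * rexp t) :=
      Filter.mem_of_superset (Ioi_mem_nhds hx) fun t ht => hdf ht
    rw [heq.deriv_eq]
    exact (hdh'.hasDerivAt.add
      (((hdP P.derivative x).mul (hasDerivAt_exp x)).const_mul (-1))).deriv
  have hfC2 : ContDiffOn ℝ 2 f (Set.Ioi 0) :=
    hC2.add (contDiffOn_const.mul (P.contDiff_aeval 2 |>.comp contDiff_exp).contDiffOn)
  have hfo : f =o[nhds x] fun t => (t - x) ^ 2 := by
    refine isLittleO_of_contDiffOn (convex_Ioi 0) isOpen_Ioi hx hfC2 ?_ ?_ ?_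
    · simp [hf, ← hy, hP₀]
    · rw [hdf hx, ← hy, hP₁, hα]
      field_simp
      ring
    · rw [hdf', hP₁, hP₂, hα, hβ]
      field_simp
      ring
  set B := max A P.natDegree with hB
  have hEB : MemEA B h := hE.mono (le_max_left _ _)
  have hPB : MemEA B fun t => P.eval (rexp t) := memEA_eval_exp P (le_max_right _ _)
  have hfB : MemEA B f := hEB.add (hPB.const_mul (-1))
  have hlim := (tendsto_Snj_of_isLittleO j hx hfB hfo).add (tendsto_Snj_eval_exp j hx P)
  rw [← hy, hP₀, hP₁, hP₂] at hlim
  refine (hlim.congr' ?_).trans_eq ?_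
  · filter_upwards [eventually_gt_atTop 0,
      tendsto_natCast_atTop_atTop.eventually (eventually_gt_atTop B)] with n hn hnB
    have hS : Snj n j f x = Snj n j h x + Snj n j (fun t => -1 * P.eval (rexp t)) x :=
      Snj_add hEB (hPB.const_mul (-1)) (by exact_mod_cast hn) hnB hx.le j
    rw [hS, Snj_const_mul]
    ring
  · congr 1
    rw [hα, hβ]
    field_simp
    ring

lemma tendsto_natCast_mul_exp_div_sub_one (p : ℝ) :
    Tendsto (fun n : ℕ => n * (rexp (p / n) - 1)) atTop (nhds p) := by
  have hderiv : HasDerivAt (fun u : ℝ => rexp (p * u)) p 0 := by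
    simpa using ((hasDerivAt_id (0 : ℝ)).const_mul p).exp
  have := (hasDerivAt_iff_tendsto_slope_zero.1 hderiv).comp
    ((tendsto_inv_atTop_nhdsGT_zero.mono_right
      (nhdsWithin_mono 0 fun u (hu : 0 < u) => hu.ne')).comp
      (tendsto_natCast_atTop_atTop (R := ℝ)))
  refine this.congr fun n => ?_
  simp [div_eq_mul_inv]

/-- If `h` is an eigenfunction of `S_{n,j}` with eigenvalue `e^{p/n}` for infinitely many
integers `n`, then `h` is an eigenfunction of `D_j²` with eigenvalue `p`. -/
theorem eigenfunction_Snj_to_D2 (j : ℤ) (A : ℝ) (hA : 0 ≤ A) (p : ℝ) (h : ℝ → ℝ)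
    (hE : MemEA A h) (hC2 : ContDiffOn ℝ 2 h (Set.Ioi 0))
    (heig : {n : ℕ | ∀ x ≥ (0:ℝ), Snj n j h x = Real.exp (p / n) * h x}.Infinite) :
    ∀ x > (0:ℝ), (1 - j) * deriv h x + x * deriv (deriv h) x = p * h x := by
  intro x hx
  have h₁ := tendsto_Snj_voronovskaja j hx hE hC2
  have h₂ := (tendsto_natCast_mul_exp_div_sub_one p).mul_const (h x)
  refine tendsto_nhds_unique_of_frequently_eq h₁ h₂ ?_
  refine (Nat.frequently_atTop_iff_infinite.2 heig).mono fun n hn => ?_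
  rw [hn x hx.le]
  ring
end

section
/- Let j ≥ 0 be an integer, m, n > 0 real numbers, and x, y ≥ 0. Then the bilinear kernel identity m·n · Σ_{k=0}^{∞} Σ_{l=0}^{∞} s_{m,k+j}(x) s_{n,l}(y) ∫_0^∞ s_{m,k}(t) s_{n,l+j}(t) dt = (mn/(m+n)) · Σ_{ν=0}^{∞} s_{mn/(m+n), ν+j}(x) · s_{mn/(m+n), ν}(y) holds. -/
open MeasureTheory Real Filter Asymptotics

/-- The Laplace integral of a product of two basis functions. -/
theorem integral_szk_mul_szk (m n : ℝ) (hm : 0 < m) (hn : 0 < n) (k i : ℕ) :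
    ∫ t in Set.Ioi (0:ℝ), szk m k t * szk n i t
      = (m / (m + n)) ^ k * (n / (m + n)) ^ i * ((k + i).choose k : ℝ) / (m + n) := by
  have hmn : 0 < m + n := add_pos hm hn
  have hI := Real.integral_rpow_mul_exp_neg_mul_Ioi (a := ((k + i : ℕ) : ℝ) + 1) (r := m + n)
    (by positivity) hmn
  have hcongr : ∀ t ∈ Set.Ioi (0:ℝ), szk m k t * szk n i t
      = m ^ k * n ^ i / (k.factorial * i.factorial)
        * (t ^ (((k + i : ℕ) : ℝ) + 1 - 1) * Real.exp (-((m + n) * t))) := by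
    intro t _
    have hexp : Real.exp (-((m + n) * t)) = Real.exp (-m * t) * Real.exp (-n * t) := by
      rw [← Real.exp_add]; ring_nf
    rw [add_sub_cancel_right, Real.rpow_natCast, hexp]
    simp only [szk, Int.toNat_natCast, not_lt.2 (Int.natCast_nonneg _), if_false]
    ring
  rw [setIntegral_congr_fun measurableSet_Ioi hcongr, integral_const_mul, hI,
    Real.Gamma_nat_eq_factorial, ← Nat.cast_add_one, Real.rpow_natCast,
    Nat.cast_add_choose, div_pow, div_pow, div_pow, one_pow]
  field_simp
  ring

/-- Vandermonde's identity with both lower indices shifted by `j`. -/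
theorem sum_choose_mul_choose_shift (j k l : ℕ) :
    ∑ ν ∈ Finset.range (k + 1), (k + j).choose (ν + j) * l.choose ν = (k + (l + j)).choose k := by
  rw [show k + (l + j) = l + (k + j) by ring, Nat.add_choose_eq,
    Finset.Nat.sum_antidiagonal_eq_sum_range_succ_mk]
  refine Finset.sum_congr rfl fun ν hν => ?_
  have hle : ν ≤ k := Nat.lt_succ_iff.1 (Finset.mem_range.1 hν)
  rw [mul_comm, Nat.choose_symm_of_eq_add (show k + j = (k - ν) + (ν + j) by omega)]

theorem summable_pow_div_factorial_mul_shift (j : ℕ) {u v : ℝ} (hu : 0 ≤ u) (hv : 0 ≤ v) :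
    Summable fun ν : ℕ => u ^ (ν + j) / (ν + j).factorial * (v ^ ν / ν.factorial) := by
  have h := (Real.summable_pow_div_factorial u).mul_of_nonneg (Real.summable_pow_div_factorial v)
    (fun i => by positivity) (fun i => by positivity)
  exact h.comp_injective (i := fun ν : ℕ => (ν + j, ν)) fun _ _ h => congrArg Prod.snd h

/-- A bilinear generating function for the binomial coefficients `(k + l + j).choose k`. -/
theorem tsum_tsum_pow_mul_choose (j : ℕ) {a b p q : ℝ} (ha : 0 ≤ a) (hb : 0 ≤ b) (hp : 0 ≤ p)
    (hq : 0 ≤ q) :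
    ∑' k : ℕ, ∑' l : ℕ, a ^ (k + j) / (k + j).factorial * (b ^ l / l.factorial)
        * (p ^ k * q ^ (l + j) * ((k + (l + j)).choose k : ℝ))
      = Real.exp (a * p + b * q) * ∑' ν : ℕ,
          (a * q) ^ (ν + j) / (ν + j).factorial * ((b * p) ^ ν / ν.factorial) := by
  set G : (ℕ × ℕ) × ℕ → ℝ := fun z =>
    a ^ (z.1.1 + j) / (z.1.1 + j).factorial * (b ^ z.1.2 / z.1.2.factorial)
      * (p ^ z.1.1 * q ^ (z.1.2 + j) * ((z.1.1 + j).choose (z.2 + j) * z.1.2.choose z.2 : ℝ))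
    with hG
  set e : (ℕ × ℕ) × ℕ → (ℕ × ℕ) × ℕ := fun z => ((z.1.1 + z.2, z.1.2 + z.2), z.2) with he
  have he_inj : Function.Injective e := by
    rintro ⟨⟨r, s⟩, ν⟩ ⟨⟨r', s'⟩, ν'⟩ h
    simp only [he, Prod.mk.injEq] at h ⊢
    omega
  have hGe : ∀ z, G (e z) = (a * p) ^ z.1.1 / z.1.1.factorial
      * ((b * q) ^ z.1.2 / z.1.2.factorial)
      * ((a * q) ^ (z.2 + j) / (z.2 + j).factorial * ((b * p) ^ z.2 / z.2.factorial)) := by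
    rintro ⟨⟨r, s⟩, ν⟩
    have h₁ : ((r + ν + j).choose (ν + j) : ℝ)
        = (r + ν + j).factorial / (r.factorial * (ν + j).factorial) := by
      rw [add_assoc, ← Nat.choose_symm_add, Nat.cast_add_choose]
    have h₂ : ((s + ν).choose ν : ℝ) = (s + ν).factorial / (s.factorial * ν.factorial) := by
      rw [← Nat.choose_symm_add, Nat.cast_add_choose]
    simp only [hG, he, h₁, h₂]
    field_simp
    ring
  have hG_zero : ∀ z ∉ Set.range e, G z = 0 := by
    rintro ⟨⟨k, l⟩, ν⟩ hz
    have : k < ν ∨ l < ν := by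
      by_contra! h
      exact hz ⟨((k - ν, l - ν), ν), by simp [he, h.1, h.2]⟩
    rcases this with h | h
    · simp [hG, Nat.choose_eq_zero_of_lt (show k + j < ν + j by omega)]
    · simp [hG, Nat.choose_eq_zero_of_lt h]
  have hexp (u : ℝ) : HasSum (fun i : ℕ => u ^ i / i.factorial) (Real.exp u) := by
    rw [Real.exp_eq_exp_ℝ]
    exact NormedSpace.expSeries_div_hasSum_exp u
  have hrs := (hexp (a * p)).mul (hexp (b * q))
    ((hexp _).summable.mul_of_nonneg (hexp _).summable (fun i => by positivity)
      (fun i => by positivity))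
  have hν := summable_pow_div_factorial_mul_shift j (mul_nonneg ha hq) (mul_nonneg hb hp)
  have hF := hrs.mul hν.hasSum (hrs.summable.mul_of_nonneg hν (fun i => by positivity)
    (fun i => by positivity))
  have hGsum := (he_inj.hasSum_iff hG_zero).1 (hF.congr_fun hGe)
  have hkl := hGsum.prod_fiberwise (g := fun z : ℕ × ℕ =>
    a ^ (z.1 + j) / (z.1 + j).factorial * (b ^ z.2 / z.2.factorial)
      * (p ^ z.1 * q ^ (z.2 + j) * ((z.1 + (z.2 + j)).choose z.1 : ℝ))) (by
    rintro ⟨k, l⟩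
    rw [← sum_choose_mul_choose_shift]
    push_cast
    simp only [Finset.mul_sum]
    refine hasSum_sum_of_ne_finset_zero fun ν hν => ?_
    have : k + j < ν + j := by simpa using hν
    simp [hG, Nat.choose_eq_zero_of_lt this])
  rw [Real.exp_add, ← hkl.tsum_eq, hkl.summable.tsum_prod]

/-- The bilinear kernel identity from the proof of the composition theorem. -/
theorem kernel_identity (j : ℕ) (m n : ℝ) (hm : 0 < m) (hn : 0 < n)
    (x y : ℝ) (hx : 0 ≤ x) (hy : 0 ≤ y) :
    m * n * ∑' k : ℕ, ∑' l : ℕ,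
        szk m ((k : ℤ) + j) x * szk n l y *
          ∫ t in Set.Ioi (0:ℝ), szk m k t * szk n ((l : ℤ) + j) t
      = m * n / (m + n) *
          ∑' ν : ℕ, szk (m * n / (m + n)) ((ν : ℤ) + j) x * szk (m * n / (m + n)) ν y := by
  have hmn : 0 < m + n := add_pos hm hn
  have hszk (r : ℝ) (k : ℕ) (t : ℝ) :
      szk r k t = (r * t) ^ k / k.factorial * Real.exp (-r * t) := by
    simp [szk]
  have hgen := tsum_tsum_pow_mul_choose j (a := m * x) (b := n * y) (p := m / (m + n))
    (q := n / (m + n)) (by positivity) (by positivity) (by positivity) (by positivity)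
  have hL (k l : ℕ) : szk m ((k : ℤ) + j) x * szk n l y *
        ∫ t in Set.Ioi (0:ℝ), szk m k t * szk n ((l : ℤ) + j) t
      = Real.exp (-m * x) * Real.exp (-n * y) / (m + n)
        * ((m * x) ^ (k + j) / (k + j).factorial * ((n * y) ^ l / l.factorial)
          * ((m / (m + n)) ^ k * (n / (m + n)) ^ (l + j) * ((k + (l + j)).choose k : ℝ))) := by
    simp only [← Nat.cast_add]
    rw [integral_szk_mul_szk m n hm hn, hszk, hszk]
    ring
  have hR (ν : ℕ) : szk (m * n / (m + n)) ((ν : ℤ) + j) x * szk (m * n / (m + n)) ν y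
      = Real.exp (-(m * n / (m + n)) * x) * Real.exp (-(m * n / (m + n)) * y)
        * ((m * x * (n / (m + n))) ^ (ν + j) / (ν + j).factorial
          * ((n * y * (m / (m + n))) ^ ν / ν.factorial)) := by
    rw [← Nat.cast_add, hszk, hszk, show m * n / (m + n) * x = m * x * (n / (m + n)) by ring,
      show m * n / (m + n) * y = n * y * (m / (m + n)) by ring]
    ring
  simp only [hL, hR, tsum_mul_left, hgen]
  have hexp : Real.exp (-m * x) * Real.exp (-n * y)
        * Real.exp (m * x * (m / (m + n)) + n * y * (n / (m + n)))
      = Real.exp (-(m * n / (m + n)) * x) * Real.exp (-(m * n / (m + n)) * y) := by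
    simp only [← Real.exp_add]
    congr 1
    field_simp
    ring
  rw [← hexp]
  ring
end

section
/- Let j ≥ 0 and k ≥ 0 be integers and z ∈ ℝ. Then Σ_{l=0}^{∞} ((l+k+j)! / ((l+j)! l!)) · z^l = e^z · Σ_{ν=0}^{k} binom(k, ν) · ((k+j)! / (ν+j)!) · z^ν. -/
open MeasureTheory Real Filter Asymptotics

/-- Vandermonde's identity, in terms of descending factorials. -/
lemma factorial_div_factorial_eq_sum_descFactorial (j k l : ℕ) :
    ((l + k + j).factorial : ℝ) / ((l + j).factorial : ℝ) =
      ∑ ν ∈ Finset.range (k + 1),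
        (k.choose ν : ℝ) * (((k + j).factorial : ℝ) / ((ν + j).factorial : ℝ)) *
          (l.descFactorial ν : ℝ) := by
  have hleft : ((l + k + j).factorial : ℝ) / ((l + j).factorial : ℝ) =
      k.factorial * ((l + (k + j)).choose k : ℝ) := by
    rw [Nat.cast_choose ℝ (by omega : k ≤ l + (k + j)), show l + (k + j) - k = l + j by omega,
      add_assoc]
    field_simp
  rw [hleft, Nat.add_choose_eq, Finset.Nat.sum_antidiagonal_eq_sum_range_succ_mk, Nat.cast_sum,
    Finset.mul_sum]
  refine Finset.sum_congr rfl fun ν hν => ?_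
  have hνk : ν ≤ k := Nat.lt_succ_iff.mp (Finset.mem_range.mp hν)
  rw [Nat.descFactorial_eq_factorial_mul_choose, Nat.cast_choose ℝ hνk]
  push_cast
  rw [Nat.cast_choose ℝ (by omega : k - ν ≤ k + j), show k + j - (k - ν) = ν + j by omega]
  field_simp

lemma hasSum_descFactorial_div_factorial_mul_pow (ν : ℕ) (z : ℝ) :
    HasSum (fun l : ℕ => (l.descFactorial ν : ℝ) / (l.factorial : ℝ) * z ^ l)
      (z ^ ν * Real.exp z) := by
  rw [← (add_left_injective ν).hasSum_iff]
  · have hexp : HasSum (fun l : ℕ => z ^ l / (l.factorial : ℝ)) (Real.exp z) := by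
      rw [Real.exp_eq_exp_ℝ]
      exact NormedSpace.expSeries_div_hasSum_exp z
    refine (hexp.mul_left (z ^ ν)).congr_fun fun l => ?_
    have hfac : (l.factorial : ℝ) * ((l + ν).descFactorial ν : ℝ) = ((l + ν).factorial : ℝ) := by
      exact_mod_cast by simpa using Nat.factorial_mul_descFactorial (Nat.le_add_left ν l)
    simp only [Function.comp_apply]
    rw [← hfac]
    have hne : ((l + ν).descFactorial ν : ℝ) ≠ 0 := by
      intro h
      rw [h, mul_zero] at hfac
      exact Nat.cast_ne_zero.mpr (Nat.factorial_ne_zero _) hfac.symm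
    field_simp
    ring
  · intro l hl
    have hlt : l < ν := by
      by_contra! h
      exact hl ⟨l - ν, Nat.sub_add_cancel h⟩
    simp [Nat.descFactorial_of_lt hlt]

/-- `Σ_{l=0}^∞ ((l+k+j)! / ((l+j)! l!)) z^l = e^z Σ_{ν=0}^k binom(k,ν) ((k+j)!/(ν+j)!) z^ν`. -/
theorem series_identity (j k : ℕ) (z : ℝ) :
    ∑' l : ℕ, ((Nat.factorial (l + k + j) : ℝ) /
          ((Nat.factorial (l + j) : ℝ) * (Nat.factorial l : ℝ))) * z ^ l
      = Real.exp z * ∑ ν ∈ Finset.range (k + 1),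
          (Nat.choose k ν : ℝ) *
            ((Nat.factorial (k + j) : ℝ) / (Nat.factorial (ν + j) : ℝ)) * z ^ ν := by
  have hsum := hasSum_sum fun ν (_ : ν ∈ Finset.range (k + 1)) =>
    (hasSum_descFactorial_div_factorial_mul_pow ν z).mul_left
      ((k.choose ν : ℝ) * (((k + j).factorial : ℝ) / ((ν + j).factorial : ℝ)))
  rw [Finset.mul_sum]
  calc
    _ = _ := tsum_congr fun l => by
      rw [← div_div, factorial_div_factorial_eq_sum_descFactorial, Finset.sum_div, Finset.sum_mul]
      exact Finset.sum_congr rfl fun ν _ => by rw [mul_div_assoc, mul_assoc]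
    _ = _ := hsum.tsum_eq
    _ = _ := Finset.sum_congr rfl fun ν _ => by ring
end

section
/- Let j ≥ 1 and l with 0 ≤ l ≤ j−1 be integers and z ∈ ℝ. Then Σ_{k=j}^{∞} (z^k / k!) · ((k+l−j)! / (k−j)!) = Σ_{i=0}^{l} binom(l, i) · (−1)^{l−i} · (j−i−1)^{\underline{l−i}} · z^i · ( e^z − Σ_{k=i}^{j−1} z^{k−i}/(k−i)! ), where a^{\underline{k}} = a(a−1)⋯(a−k+1) denotes the falling factorial. -/
open MeasureTheory Real Filter Asymptotics

theorem fallFac_eq_smeval (a : ℤ) (k : ℕ) : fallFac a k = (descPochhammer ℤ k).smeval a := by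
  rw [← Polynomial.eval_eq_smeval, descPochhammer_eval_eq_prod_range, fallFac]

theorem fallFac_natCast (n k : ℕ) : fallFac n k = n.descFactorial k := by
  rw [fallFac_eq_smeval, Polynomial.descPochhammer_smeval_eq_descFactorial]

/-- The Chu-Vandermonde identity for falling factorials. -/
theorem fallFac_add (a b : ℤ) (l : ℕ) :
    fallFac (a + b) l =
      ∑ i ∈ Finset.range (l + 1), (l.choose i : ℤ) * (fallFac a i * fallFac b (l - i)) := by
  simp only [fallFac_eq_smeval, Ring.descPochhammer_smeval_add l (Commute.all a b),
    Finset.Nat.sum_antidiagonal_eq_sum_range_succ_mk]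

theorem fallFac_neg (a : ℤ) (k : ℕ) : fallFac (-a) k = (-1) ^ k * fallFac (a + k - 1) k := by
  unfold fallFac
  rw [← Finset.prod_range_reflect (fun t : ℕ => a + k - 1 - (t : ℤ)), ← Finset.card_range k,
    ← Finset.prod_const, Finset.card_range, ← Finset.prod_mul_distrib]
  refine Finset.prod_congr rfl fun t ht => ?_
  have := Finset.mem_range.1 ht
  rw [show ((k - 1 - t : ℕ) : ℤ) = k - 1 - t by omega]
  ring

theorem descFactorial_add_eq_sum (j l k : ℕ) :
    ((k + l).descFactorial l : ℤ) =
      ∑ i ∈ Finset.range (l + 1), (l.choose i : ℤ) * (-1) ^ (l - i) *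
        fallFac ((j : ℤ) - i - 1) (l - i) * (j + k).descFactorial i := by
  rw [← fallFac_natCast, show ((k + l : ℕ) : ℤ) = ((j + k : ℕ) : ℤ) + -((j : ℤ) - l) by
    push_cast; ring, fallFac_add]
  refine Finset.sum_congr rfl fun i hi => ?_
  have := Finset.mem_range.1 hi
  rw [fallFac_neg, fallFac_natCast,
    show (j : ℤ) - l + (l - i : ℕ) - 1 = j - i - 1 by omega]
  ring

theorem hasSum_exp_tail_mul_descFactorial {i j : ℕ} (hij : i ≤ j) (z : ℝ) :
    HasSum (fun k : ℕ => z ^ (j + k) / ((j + k).factorial : ℝ) * ((j + k).descFactorial i : ℝ))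
      (z ^ i * (Real.exp z - ∑ k ∈ Finset.Ico i j, z ^ (k - i) / ((k - i).factorial : ℝ))) := by
  have h := (hasSum_nat_add_iff' (j - i)).2 (NormedSpace.expSeries_div_hasSum_exp z)
  rw [← Real.exp_eq_exp_ℝ] at h
  rw [Finset.sum_Ico_eq_sum_range]
  simp only [Nat.add_sub_cancel_left]
  convert! h.mul_left (z ^ i) using 2 with k
  have hf := Nat.factorial_mul_descFactorial (show i ≤ j + k by omega)
  rw [show j + k - i = k + (j - i) by omega] at hf
  rw [← hf, show j + k = i + (k + (j - i)) by omega, pow_add]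
  have : ((i + (k + (j - i))).descFactorial i : ℝ) ≠ 0 := by
    rw [Nat.cast_ne_zero, Ne, Nat.descFactorial_eq_zero_iff_lt]
    omega
  push_cast
  field_simp

/-- `Σ_{k=j}^∞ (z^k/k!)((k+l-j)!/(k-j)!)`, reindexed via `k = j + k'`, equals
`Σ_{i=0}^l binom(l,i)(-1)^{l-i}(j-i-1)^{underline{l-i}} z^i (e^z - Σ_{k=i}^{j-1} z^{k-i}/(k-i)!)`. -/
theorem series_identity_leibniz (j l : ℕ) (hj : 1 ≤ j) (hl : l ≤ j - 1) (z : ℝ) :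
    ∑' k : ℕ, z ^ (j + k) / (Nat.factorial (j + k) : ℝ) *
        ((Nat.factorial (k + l) : ℝ) / (Nat.factorial k : ℝ))
      = ∑ i ∈ Finset.range (l + 1),
          (Nat.choose l i : ℝ) * (-1 : ℝ) ^ (l - i) * (fallFac ((j : ℤ) - i - 1) (l - i) : ℝ) *
            z ^ i *
            (Real.exp z - ∑ k ∈ Finset.Icc i (j - 1), z ^ (k - i) / (Nat.factorial (k - i) : ℝ)) := by
  have hterm (k : ℕ) : z ^ (j + k) / ((j + k).factorial : ℝ) *
      (((k + l).factorial : ℝ) / (k.factorial : ℝ)) =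
      ∑ i ∈ Finset.range (l + 1), (Nat.choose l i : ℝ) * (-1 : ℝ) ^ (l - i) *
        (fallFac ((j : ℤ) - i - 1) (l - i) : ℝ) *
          (z ^ (j + k) / ((j + k).factorial : ℝ) * ((j + k).descFactorial i : ℝ)) := by
    have hd := congrArg (Int.cast : ℤ → ℝ) (descFactorial_add_eq_sum j l k)
    push_cast at hd
    have hf := Nat.factorial_mul_descFactorial (Nat.le_add_left l k)
    rw [Nat.add_sub_cancel] at hf
    rw [← hf, Nat.cast_mul, mul_div_cancel_left₀ _ (by positivity), hd, Finset.mul_sum]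
    exact Finset.sum_congr rfl fun i _ => by ring
  simp_rw [hterm]
  refine (hasSum_sum fun i hi => ?_).tsum_eq
  have hi := Finset.mem_range.1 hi
  rw [mul_assoc _ (z ^ i), show Finset.Icc i (j - 1) = Finset.Ico i j by
    ext k; simp only [Finset.mem_Icc, Finset.mem_Ico]; omega]
  exact (hasSum_exp_tail_mul_descFactorial (by omega) z).mul_left _
end
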